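/- Let Z be a separable real Banach space, Y = Z* its (strong) dual, and let A : ℓ¹ → Y be a bounded linear operator that is injective and sequentially weak*-to-weak* continuous. Then for every ε > 0, every n ∈ ℕ, and every real sequence ξ with ξ_k → 0, there exists f ∈ Y* such that f(A e^{(k)}) = ξ_k for all k ≤ n and |f(A e^{(k)}) − ξ_k| ≤ ε for all k > n. -/

import Mathlib

open Filter Topology

/-- The `k`-th standard unit vector in `ℓ¹`. -/
noncomputable def stdUnit (k : ℕ) : lp (fun _ : ℕ => ℝ) 1 := lp.single 1 k 1

/-- A sequence in `ℓ¹` converges weakly* (duality with the predual `c₀`). -/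
def WeakStarTendsto (x : ℕ → lp (fun _ : ℕ => ℝ) 1) (x₀ : lp (fun _ : ℕ => ℝ) 1) : Prop :=
  ∀ u : ℕ → ℝ, Tendsto u atTop (nhds 0) →
    Tendsto (fun n => ∑' k : ℕ, (x n : ℕ → ℝ) k * u k) atTop
      (nhds (∑' k : ℕ, (x₀ : ℕ → ℝ) k * u k))

open scoped ENNReal

/-- A null sequence is the sum, in `ℓ∞`, of its coordinate vectors. -/
theorem hasSum_single_of_tendsto_zero (u : lp (fun _ : ℕ => ℝ) ∞)
    (hu : Tendsto (u : ℕ → ℝ) atTop (𝓝 0)) :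
    HasSum (fun k => lp.single ∞ k (u k : ℝ)) u := by
  rw [HasSum, Metric.tendsto_nhds]
  intro ε hε
  rw [← Nat.cofinite_eq_atTop, Metric.tendsto_nhds] at hu
  have hfin := hu (ε / 2) (half_pos hε)
  rw [Filter.eventually_cofinite] at hfin
  filter_upwards [eventually_ge_atTop hfin.toFinset] with s hs
  rw [dist_eq_norm]
  refine lt_of_le_of_lt (lp.norm_le_of_forall_le (half_pos hε).le fun i => ?_) (half_lt_self hε)
  simp only [lp.coeFn_sub, lp.coeFn_sum, Pi.sub_apply, Finset.sum_apply, lp.coeFn_single,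
    Finset.sum_pi_single]
  split_ifs with hi
  · simpa using (half_pos hε).le
  · by_contra! h
    refine hi (hs ?_)
    simpa using h.le

/-- A continuous functional on `ℓ∞` is absolutely summable along the unit vectors. -/
theorem summable_abs_apply_single (φ : lp (fun _ : ℕ => ℝ) ∞ →L[ℝ] ℝ) :
    Summable fun k => |φ (lp.single ∞ k (1 : ℝ))| := by
  refine summable_of_sum_le (c := ‖φ‖) (fun _ => abs_nonneg _) fun s => ?_
  set v : lp (fun _ : ℕ => ℝ) ∞ :=
    ∑ k ∈ s, lp.single ∞ k (SignType.sign (φ (lp.single ∞ k (1 : ℝ))) : ℝ) with hv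
  have hnorm : ‖v‖ ≤ 1 := by
    refine lp.norm_le_of_forall_le zero_le_one fun i => ?_
    simp only [hv, lp.coeFn_sum, Finset.sum_apply, lp.coeFn_single, Finset.sum_pi_single]
    split_ifs
    · rcases SignType.sign (φ (lp.single ∞ i (1 : ℝ))) with _ | _ | _ <;> simp
    · simp
  have hval : φ v = ∑ k ∈ s, |φ (lp.single ∞ k (1 : ℝ))| := by
    rw [hv, map_sum]
    refine Finset.sum_congr rfl fun k _ => ?_
    have h : lp.single (E := fun _ : ℕ => ℝ) ∞ k
        (SignType.sign (φ (lp.single ∞ k (1 : ℝ))) : ℝ) =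
        (SignType.sign (φ (lp.single ∞ k (1 : ℝ))) : ℝ) • lp.single ∞ k (1 : ℝ) := by
      rw [← lp.single_smul, smul_eq_mul, mul_one]
    rw [h, map_smul, smul_eq_mul, sign_mul_self]
  calc ∑ k ∈ s, |φ (lp.single ∞ k (1 : ℝ))| = φ v := hval.symm
    _ ≤ ‖φ v‖ := Real.le_norm_self _
    _ ≤ ‖φ‖ * ‖v‖ := φ.le_opNorm v
    _ ≤ ‖φ‖ := mul_le_of_le_one_right (norm_nonneg _) hnorm

/-- Unit vectors of `ℓ¹` converge weakly* to zero. -/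
theorem weakStarTendsto_stdUnit : WeakStarTendsto stdUnit 0 := by
  intro u hu
  have h : ∀ n, ∑' k, (stdUnit n : ℕ → ℝ) k * u k = u n := fun n => by
    rw [tsum_eq_single n fun k hk => by simp [stdUnit, Pi.single_eq_of_ne hk]]
    simp [stdUnit]
  simpa [h] using hu

/-- A point outside the closure of a subspace is detected by a continuous functional vanishing on
the subspace. -/
theorem exists_dual_eq_zero_of_notMem_closure {E : Type*} [NormedAddCommGroup E]
    [NormedSpace ℝ E] (V : Submodule ℝ E) {x : E} (hx : x ∉ closure (V : Set E)) :
    ∃ φ : E →L[ℝ] ℝ, (∀ v ∈ V, φ v = 0) ∧ φ x ≠ 0 := by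
  obtain ⟨φ, c, hφ, hc⟩ :=
    geometric_hahn_banach_closed_point V.convex.closure isClosed_closure hx
  have hc0 : 0 < c := by simpa using hφ 0 (subset_closure V.zero_mem)
  refine ⟨φ, fun v hv => ?_, (hc0.trans hc).ne'⟩
  by_contra h
  have := hφ _ (subset_closure (V.smul_mem (c / φ v) hv))
  rw [map_smul, smul_eq_mul, div_mul_cancel₀ _ h] at this
  exact this.false

section

variable {Z : Type*} [NormedAddCommGroup Z] [NormedSpace ℝ Z]

/-- The coefficients of `z` under the preadjoint of `A`, as an element of `ℓ∞`. -/
noncomputable def preadjoint (A : lp (fun _ : ℕ => ℝ) 1 →L[ℝ] (Z →L[ℝ] ℝ)) :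
    Z →ₗ[ℝ] lp (fun _ : ℕ => ℝ) ∞ where
  toFun z := ⟨fun k => A (stdUnit k) z, memℓp_infty ⟨‖A‖ * ‖z‖, by
    rintro _ ⟨k, rfl⟩
    have hk : ‖stdUnit k‖ = 1 := by simp [stdUnit, lp.norm_single]
    calc ‖A (stdUnit k) z‖ ≤ ‖A (stdUnit k)‖ * ‖z‖ := (A (stdUnit k)).le_opNorm z
      _ ≤ ‖A‖ * ‖z‖ := by
        gcongr
        simpa [hk] using A.le_opNorm (stdUnit k)⟩⟩
  map_add' x y := by ext k; exact map_add (A (stdUnit k)) x y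
  map_smul' c x := by ext k; exact map_smul (A (stdUnit k)) c x

theorem hasSum_apply_stdUnit (A : lp (fun _ : ℕ => ℝ) 1 →L[ℝ] (Z →L[ℝ] ℝ))
    (a : lp (fun _ : ℕ => ℝ) 1) (z : Z) :
    HasSum (fun k => a k * A (stdUnit k) z) (A a z) := by
  have h : ∀ k, lp.single (E := fun _ : ℕ => ℝ) 1 k (a k) = a k • stdUnit k := fun k => by
    rw [stdUnit, ← lp.single_smul, smul_eq_mul, mul_one]
  simpa only [h, map_smul, smul_eq_mul, ContinuousLinearMap.apply_apply] using
    ((lp.hasSum_single ENNReal.one_ne_top a).mapL A).mapL (ContinuousLinearMap.apply ℝ ℝ z)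

/-- If `A` is injective and each `z` has null coefficients, these coefficients
approximate every null sequence uniformly. -/
theorem exists_forall_abs_apply_stdUnit_sub_le
    {A : lp (fun _ : ℕ => ℝ) 1 →L[ℝ] (Z →L[ℝ] ℝ)} (hinj : Function.Injective A)
    (hnull : ∀ z : Z, Tendsto (fun k => A (stdUnit k) z) atTop (𝓝 0))
    {ξ : ℕ → ℝ} (hξ : Tendsto ξ atTop (𝓝 0)) {ε : ℝ} (hε : 0 < ε) :
    ∃ z : Z, ∀ k, |A (stdUnit k) z - ξ k| ≤ ε := by
  have hmem : Memℓp ξ ∞ := memℓp_infty (by simpa using hξ.norm.bddAbove_range)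
  set x : lp (fun _ : ℕ => ℝ) ∞ := ⟨ξ, hmem⟩
  by_cases hx : x ∈ closure (LinearMap.range (preadjoint A) : Set (lp (fun _ : ℕ => ℝ) ∞))
  · obtain ⟨_, ⟨z, rfl⟩, hz⟩ := Metric.mem_closure_iff.1 hx ε hε
    refine ⟨z, fun k => ?_⟩
    rw [dist_comm, dist_eq_norm] at hz
    exact (lp.norm_apply_le_norm ENNReal.top_ne_zero (preadjoint A z - x) k).trans hz.le
  · obtain ⟨φ, hφ, hφx⟩ := exists_dual_eq_zero_of_notMem_closure _ hx
    have hexp : ∀ u : lp (fun _ : ℕ => ℝ) ∞, Tendsto (u : ℕ → ℝ) atTop (𝓝 0) →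
        HasSum (fun k => φ (lp.single ∞ k (1 : ℝ)) * u k) (φ u) := fun u hu => by
      convert (hasSum_single_of_tendsto_zero u hu).mapL φ using 2 with k
      rw [mul_comm, ← smul_eq_mul, ← map_smul, ← lp.single_smul, smul_eq_mul, mul_one]
    let a : lp (fun _ : ℕ => ℝ) 1 := ⟨fun k => φ (lp.single ∞ k (1 : ℝ)),
      memℓp_gen (by simpa using summable_abs_apply_single φ)⟩
    have ha : A a = 0 := by
      ext z
      exact ((hasSum_apply_stdUnit A a z).unique (hexp (preadjoint A z) (hnull z))).trans
        (hφ _ (LinearMap.mem_range_self (preadjoint A) z))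
    have ha0 : a = 0 := hinj (ha.trans (map_zero A).symm)
    refine absurd ?_ hφx
    have h0 : ∀ k, φ (lp.single ∞ k (1 : ℝ)) = 0 := fun k =>
      congrArg (fun b : lp (fun _ : ℕ => ℝ) 1 => (b : ℕ → ℝ) k) ha0
    have := hexp x hξ
    simp only [h0, zero_mul] at this
    exact this.unique hasSum_zero

/-- The approximation can be made exact on finitely many coordinates. -/
theorem exists_eqOn_forall_abs_apply_stdUnit_sub_le
    {A : lp (fun _ : ℕ => ℝ) 1 →L[ℝ] (Z →L[ℝ] ℝ)} (hinj : Function.Injective A)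
    (hnull : ∀ z : Z, Tendsto (fun k => A (stdUnit k) z) atTop (𝓝 0)) (n : ℕ) :
    ∀ {ξ : ℕ → ℝ}, Tendsto ξ atTop (𝓝 0) → ∀ {ε : ℝ}, 0 < ε →
      ∃ z : Z, (∀ k < n, A (stdUnit k) z = ξ k) ∧ ∀ k, |A (stdUnit k) z - ξ k| ≤ ε := by
  induction n with
  | zero =>
    intro ξ hξ ε hε
    obtain ⟨z, hz⟩ := exists_forall_abs_apply_stdUnit_sub_le hinj hnull hξ hε
    exact ⟨z, by simp, hz⟩
  | succ n ih =>
    intro ξ hξ ε hε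
    have hunit : Tendsto (Pi.single n 1 : ℕ → ℝ) atTop (𝓝 0) :=
      tendsto_const_nhds.congr' (by
        filter_upwards [eventually_gt_atTop n] with k hk
        exact (Pi.single_eq_of_ne (M := fun _ => ℝ) hk.ne' 1).symm)
    obtain ⟨w, hw, hw'⟩ := ih hunit one_half_pos
    obtain ⟨z, hz, hz'⟩ := ih hξ (show 0 < ε / 4 by positivity)
    have hwn : 1 / 2 ≤ A (stdUnit n) w := by
      have := (abs_le.1 (hw' n)).1
      rw [Pi.single_eq_same] at this
      linarith
    have hwle : ∀ k, |A (stdUnit k) w| ≤ 3 / 2 := fun k => by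
      have h1 : |(Pi.single n 1 : ℕ → ℝ) k| ≤ 1 := by
        by_cases h : k = n
        · subst h; simp
        · simp [Pi.single_eq_of_ne h]
      have := abs_sub_abs_le_abs_sub (A (stdUnit k) w) ((Pi.single n 1 : ℕ → ℝ) k)
      linarith [hw' k]
    set c := (ξ n - A (stdUnit n) z) / A (stdUnit n) w with hc
    have hcle : |c| ≤ ε / 2 := by
      rw [hc, abs_div, abs_of_pos (by linarith : 0 < A (stdUnit n) w),
        div_le_iff₀ (by linarith), abs_sub_comm]
      nlinarith [hz' n]
    refine ⟨z + c • w, fun k hk => ?_, fun k => ?_⟩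
    · rw [map_add, map_smul, smul_eq_mul]
      rcases (Nat.lt_succ_iff_lt_or_eq.1 hk) with hk | rfl
      · rw [hw k hk, Pi.single_eq_of_ne hk.ne, mul_zero, add_zero, hz k hk]
      · rw [hc, div_mul_cancel₀ _ (by linarith)]
        ring
    · rw [map_add, map_smul, smul_eq_mul, add_sub_right_comm]
      calc |A (stdUnit k) z - ξ k + c * A (stdUnit k) w|
          ≤ |A (stdUnit k) z - ξ k| + |c| * |A (stdUnit k) w| := by
            rw [← abs_mul]; exact abs_add_le _ _
        _ ≤ ε / 4 + ε / 2 * (3 / 2) := by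
            gcongr
            · exact hz' k
            · exact hwle k
        _ = ε := by ring

end

/-- if `A : ℓ¹ → Y = Z*` is injective and sequentially weak*-to-weak*
continuous, then for every `ε > 0`, `n ∈ ℕ` and `ξ ∈ c₀` there is `f ∈ Y*` whose adjoint
representation `(f(A e^{(k)}))_k` agrees with `ξ` on the first `n` entries and is
`ε`-close to `ξ` on the tail.  (Indices are 0-based: the first `n` entries are `k < n`.) -/
theorem stmt_5 {Z : Type*} [NormedAddCommGroup Z] [NormedSpace ℝ Z] [CompleteSpace Z]
    [TopologicalSpace.SeparableSpace Z]
    (A : lp (fun _ : ℕ => ℝ) 1 →L[ℝ] (Z →L[ℝ] ℝ))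
    (hinj : Function.Injective A)
    (hcont : ∀ (x : ℕ → lp (fun _ : ℕ => ℝ) 1) (x₀ : lp (fun _ : ℕ => ℝ) 1),
      WeakStarTendsto x x₀ →
      ∀ z : Z, Tendsto (fun n => (A (x n)) z) atTop (nhds ((A x₀) z))) :
    ∀ ε : ℝ, 0 < ε → ∀ n : ℕ, ∀ ξ : ℕ → ℝ, Tendsto ξ atTop (nhds 0) →
      ∃ f : (Z →L[ℝ] ℝ) →L[ℝ] ℝ,
        (∀ k < n, f (A (stdUnit k)) = ξ k) ∧
        (∀ k, n ≤ k → |f (A (stdUnit k)) - ξ k| ≤ ε) := by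
  intro ε hε n ξ hξ
  have hnull : ∀ z : Z, Tendsto (fun k => A (stdUnit k) z) atTop (𝓝 0) := fun z => by
    simpa using hcont stdUnit 0 weakStarTendsto_stdUnit z
  obtain ⟨z, hz, hz'⟩ := exists_eqOn_forall_abs_apply_stdUnit_sub_le hinj hnull n hξ hε
  exact ⟨ContinuousLinearMap.apply ℝ ℝ z, hz, fun k _ => hz' k⟩
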